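/- Let r > 2 and define f₂(r) = [1 + √8·((r−2)/r) + (π/2)·((r−2)/r)²] / [(1/2)·((r−2)/r)²·(√(1/2))^(−log 4/log r)·((r−2)/r)^(−log 4/log r)]. Then for every n ∈ ℕ, with ε = √(1/2)·((r−2)/r)·r^(−n), one has λ²((C^r)_ε) / ε^(2 − D_r) < f₂(r), where D_r = log 4 / log r. -/

import Mathlib

open MeasureTheory Metric Set Real Filter Topology ENNReal

/-- The similarity map `x ↦ x/r + (a, b)` of the plane. -/
noncomputable def cantorMap (r a b : ℝ) (x : EuclideanSpace ℝ (Fin 2)) :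
    EuclideanSpace ℝ (Fin 2) :=
  r⁻¹ • x + (WithLp.equiv 2 (Fin 2 → ℝ)).symm ![a, b]

/-- `C` is the Cantor dust with parameter `r`: the (unique) nonempty compact set invariant
under the four similarities `S₁, S₂, S₃, S₄`. -/
def IsCantorDust (r : ℝ) (C : Set (EuclideanSpace ℝ (Fin 2))) : Prop :=
  IsCompact C ∧ C.Nonempty ∧
    C = cantorMap r 0 0 '' C ∪ cantorMap r ((r - 1) / r) 0 '' C ∪
        cantorMap r ((r - 1) / r) ((r - 1) / r) '' C ∪ cantorMap r 0 ((r - 1) / r) '' C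

/-- The lower-bound function `f₁` from Equation (12) of the paper. -/
noncomputable def f₁ (r : ℝ) : ℝ :=
  (1 + 2 * ((r - 2) / r) * Real.sqrt (r ^ 2 - 1) + 3 * ((r - 2) / r) -
      3 / r * ((r - 2) / r) * Real.sqrt (r ^ 2 - 1) +
      ((r - 2) / r) ^ 2 * (r - Real.sqrt (r ^ 2 - 1) + r ^ 2 * π / 4)) /
    (1 / 4 * (r - 2) ^ 2 * (1 / 2 : ℝ) ^ (-(Real.log 4 / Real.log r)) *
      (r - 2) ^ (-(Real.log 4 / Real.log r)))

/-- The upper-bound function `f₂` from Equation (15) of the paper. -/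
noncomputable def f₂ (r : ℝ) : ℝ :=
  (1 + Real.sqrt 8 * ((r - 2) / r) + π / 2 * ((r - 2) / r) ^ 2) /
    (1 / 2 * ((r - 2) / r) ^ 2 * Real.sqrt (1 / 2) ^ (-(Real.log 4 / Real.log r)) *
      ((r - 2) / r) ^ (-(Real.log 4 / Real.log r)))

open scoped Pointwise

local notation "E" => EuclideanSpace ℝ (Fin 2)

lemma IsCantorDust.exists_preimage {r : ℝ} {C : Set E} (hC : IsCantorDust r C) {y : E}
    (hy : y ∈ C) : ∃ a b : ℝ, ∃ z ∈ C, (a = 0 ∨ a = (r - 1) / r) ∧ (b = 0 ∨ b = (r - 1) / r) ∧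
      cantorMap r a b z = y := by
  rw [hC.2.2] at hy
  rcases hy with ((⟨z, hz, rfl⟩ | ⟨z, hz, rfl⟩) | ⟨z, hz, rfl⟩) | ⟨z, hz, rfl⟩
  all_goals exact ⟨_, _, z, hz, by simp, by simp, rfl⟩

lemma cantorMap_apply_zero (r a b : ℝ) (x : E) : cantorMap r a b x 0 = x 0 / r + a := by
  simp [cantorMap]; ring

lemma cantorMap_apply_one (r a b : ℝ) (x : E) : cantorMap r a b x 1 = x 1 / r + b := by
  simp [cantorMap]; ring

lemma IsCantorDust.exists_coord {r : ℝ} {C : Set E} (hC : IsCantorDust r C) (i : Fin 2) {y : E}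
    (hy : y ∈ C) : ∃ z ∈ C, y i = z i / r ∨ y i = z i / r + (r - 1) / r := by
  obtain ⟨a, b, z, hz, ha, hb, rfl⟩ := hC.exists_preimage hy
  refine ⟨z, hz, ?_⟩
  fin_cases i
  · rcases ha with rfl | rfl <;> simp [cantorMap_apply_zero]
  · rcases hb with rfl | rfl <;> simp [cantorMap_apply_one]

lemma IsCantorDust.coord_mem_Icc {r : ℝ} (hr : 2 < r) {C : Set E} (hC : IsCantorDust r C)
    (i : Fin 2) {y : E} (hy : y ∈ C) : y i ∈ Icc (0 : ℝ) 1 := by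
  have hcont : ContinuousOn (fun x : E => x i) C := by fun_prop
  have hr0 : 0 < r := by linarith
  constructor
  · obtain ⟨m, hm, hmin⟩ := hC.1.exists_isMinOn hC.2.1 hcont
    obtain ⟨z, hz, h⟩ := hC.exists_coord i hm
    have hmz : m i ≤ z i := hmin hz
    have hmy : m i ≤ y i := hmin hy
    have : z i / r ≤ m i := by
      have : 0 ≤ (r - 1) / r := div_nonneg (by linarith) hr0.le
      rcases h with h | h <;> linarith
    rw [div_le_iff₀ hr0] at this
    nlinarith
  · obtain ⟨m, hm, hmax⟩ := hC.1.exists_isMaxOn hC.2.1 hcont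
    obtain ⟨z, hz, h⟩ := hC.exists_coord i hm
    have hmz : z i ≤ m i := hmax hz
    have hmy : y i ≤ m i := hmax hy
    have : m i ≤ (z i + (r - 1)) / r := by
      have : 0 ≤ (r - 1) / r := div_nonneg (by linarith) hr0.le
      rw [add_div]
      rcases h with h | h <;> linarith
    rw [le_div_iff₀ hr0] at this
    nlinarith

lemma IsCantorDust.coord_le_or_ge {r : ℝ} (hr : 2 < r) {C : Set E} (hC : IsCantorDust r C)
    (i : Fin 2) {y : E} (hy : y ∈ C) : y i ≤ 1 / r ∨ 1 - 1 / r ≤ y i := by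
  have hr0 : 0 < r := by linarith
  obtain ⟨z, hz, h⟩ := hC.exists_coord i hy
  obtain ⟨h0, h1⟩ := hC.coord_mem_Icc hr i hz
  rcases h with h | h <;> rw [h]
  · left; gcongr
  · right
    rw [sub_div, div_self hr0.ne']
    have : 0 ≤ z i / r := by positivity
    linarith

lemma volume_image_cantorMap {r : ℝ} (hr : 0 < r) (a b : ℝ) (S : Set E) :
    volume.real (cantorMap r a b '' S) = volume.real S / r ^ 2 := by
  have h : cantorMap r a b '' S =
      (fun x => x + (WithLp.equiv 2 (Fin 2 → ℝ)).symm ![a, b]) '' (r⁻¹ • S) := by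
    rw [← image_smul, image_image]; rfl
  rw [h, measureReal_def, image_add_right, measure_preimage_add_right, Measure.addHaar_smul,
    finrank_euclideanSpace_fin, ENNReal.toReal_mul, ENNReal.toReal_ofReal (abs_nonneg _),
    abs_of_nonneg (by positivity), measureReal_def]
  field_simp

lemma mem_image_cantorMap_cthickening {r : ℝ} (hr : 0 < r) (a b δ : ℝ) {C : Set E}
    {y x : E} (hy : y ∈ C) (hx : dist x (cantorMap r a b y) ≤ δ / r) :
    x ∈ cantorMap r a b '' cthickening δ C := by
  set v : E := (WithLp.equiv 2 (Fin 2 → ℝ)).symm ![a, b] with hv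
  refine ⟨r • (x - v), mem_cthickening_of_dist_le _ y _ _ hy ?_, ?_⟩
  · have h1 : r • (x - v) - y = r • (x - cantorMap r a b y) := by
      simp only [cantorMap, ← hv, smul_sub, smul_add, smul_inv_smul₀ hr.ne']
      abel
    rw [dist_eq_norm, h1, norm_smul, Real.norm_of_nonneg hr.le, ← dist_eq_norm]
    rwa [le_div_iff₀' hr] at hx
  · simp only [cantorMap, ← hv, inv_smul_smul₀ hr.ne', sub_add_cancel]

lemma IsCantorDust.volume_cthickening_div_le {r : ℝ} (hr : 2 < r) {C : Set E}
    (hC : IsCantorDust r C) {δ : ℝ} (hδ : 0 ≤ δ) :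
    volume.real (cthickening (δ / r) C) ≤ 4 / r ^ 2 * volume.real (cthickening δ C) := by
  have hr0 : 0 < r := by linarith
  have hsub : cthickening (δ / r) C ⊆
      cantorMap r 0 0 '' cthickening δ C ∪ cantorMap r ((r - 1) / r) 0 '' cthickening δ C ∪
        cantorMap r ((r - 1) / r) ((r - 1) / r) '' cthickening δ C ∪
        cantorMap r 0 ((r - 1) / r) '' cthickening δ C := by
    intro x hx
    rw [hC.1.cthickening_eq_biUnion_closedBall (by positivity)] at hx
    obtain ⟨y, hy, hxy⟩ := mem_iUnion₂.1 hx
    rw [mem_closedBall] at hxy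
    obtain ⟨a, b, z, hz, ha, hb, rfl⟩ := hC.exists_preimage hy
    have := mem_image_cantorMap_cthickening hr0 a b δ hz hxy
    rcases ha with rfl | rfl <;> rcases hb with rfl | rfl <;> simp only [mem_union] <;> tauto
  have hK : IsCompact (cthickening δ C) := hC.1.cthickening
  have hfin (a b : ℝ) : volume (cantorMap r a b '' cthickening δ C) ≠ ⊤ :=
    (hK.image (by unfold cantorMap; fun_prop)).measure_lt_top.ne
  refine (measureReal_mono hsub (by simp [hfin])).trans ?_
  refine (measureReal_union_le _ _).trans ?_
  have h1 := measureReal_union_le (μ := volume) (cantorMap r 0 0 '' cthickening δ C)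
    (cantorMap r ((r - 1) / r) 0 '' cthickening δ C)
  have h2 := measureReal_union_le (μ := volume) (cantorMap r 0 0 '' cthickening δ C ∪
    cantorMap r ((r - 1) / r) 0 '' cthickening δ C)
    (cantorMap r ((r - 1) / r) ((r - 1) / r) '' cthickening δ C)
  simp only [volume_image_cantorMap hr0] at h1 h2 ⊢
  have h3 : 4 / r ^ 2 * volume.real (cthickening δ C) =
    4 * (volume.real (cthickening δ C) / r ^ 2) := by ring
  linarith

lemma IsCantorDust.volume_cthickening_mul_pow_le {r : ℝ} (hr : 2 < r) {C : Set E}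
    (hC : IsCantorDust r C) {δ : ℝ} (hδ : 0 ≤ δ) (n : ℕ) :
    volume.real (cthickening (δ / r ^ n) C) ≤
      (4 / r ^ 2) ^ n * volume.real (cthickening δ C) := by
  have hr0 : 0 < r := by linarith
  induction n with
  | zero => simp
  | succ n ih =>
    rw [pow_succ, ← div_div, pow_succ', mul_assoc]
    refine (hC.volume_cthickening_div_le hr (by positivity)).trans ?_
    gcongr

/-- The axis-parallel rectangle `[a, b] × [c, d]`. -/
def planeBox (a b c d : ℝ) : Set E := {x | (a ≤ x 0 ∧ x 0 ≤ b) ∧ c ≤ x 1 ∧ x 1 ≤ d}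

lemma volume_planeBox (a b c d : ℝ) :
    volume (planeBox a b c d) = ENNReal.ofReal (b - a) * ENNReal.ofReal (d - c) := by
  have h : planeBox a b c d =
      (MeasurableEquiv.toLp 2 (Fin 2 → ℝ)).symm ⁻¹' Icc ![a, c] ![b, d] := by
    ext x
    simp [planeBox, Pi.le_def, Fin.forall_fin_two]
    tauto
  rw [h, (EuclideanSpace.volume_preserving_symm_measurableEquiv_toLp
    (Fin 2)).measure_preimage measurableSet_Icc.nullMeasurableSet, Real.volume_Icc_pi]
  simp

lemma volume_real_planeBox {a b c d : ℝ} (hab : a ≤ b) (hcd : c ≤ d) :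
    volume.real (planeBox a b c d) = (b - a) * (d - c) := by
  rw [measureReal_def, volume_planeBox, ENNReal.toReal_mul, ENNReal.toReal_ofReal (by linarith),
    ENNReal.toReal_ofReal (by linarith)]

/-- The open quadrants of a disc, each translated by its own vector, have total area at most that of
the disc. -/
lemma volume_translated_quadrants_le {ε : ℝ} (hε : 0 ≤ ε) (v₁ v₂ v₃ v₄ : E) :
    volume.real {x : E | x - v₁ ∈ closedBall 0 ε ∧ (x - v₁) 0 < 0 ∧ (x - v₁) 1 < 0} +
      volume.real {x : E | x - v₂ ∈ closedBall 0 ε ∧ (x - v₂) 0 < 0 ∧ 0 < (x - v₂) 1} +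
      volume.real {x : E | x - v₃ ∈ closedBall 0 ε ∧ 0 < (x - v₃) 0 ∧ (x - v₃) 1 < 0} +
      volume.real {x : E | x - v₄ ∈ closedBall 0 ε ∧ 0 < (x - v₄) 0 ∧ 0 < (x - v₄) 1} ≤
      π * ε ^ 2 := by
  have key (v : E) (p : E → Prop) : volume.real {x : E | p (x - v)} = volume.real {x | p x} := by
    rw [measureReal_def, measureReal_def, ← measure_preimage_add_right volume (-v) {x | p x}]
    simp [sub_eq_add_neg]
  rw [key v₁ (fun x => x ∈ closedBall 0 ε ∧ x 0 < 0 ∧ x 1 < 0),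
    key v₂ (fun x => x ∈ closedBall 0 ε ∧ x 0 < 0 ∧ 0 < x 1),
    key v₃ (fun x => x ∈ closedBall 0 ε ∧ 0 < x 0 ∧ x 1 < 0),
    key v₄ (fun x => x ∈ closedBall 0 ε ∧ 0 < x 0 ∧ 0 < x 1)]
  have hD : volume.real (closedBall (0 : E) ε) = π * ε ^ 2 := by
    rw [measureReal_def, EuclideanSpace.volume_closedBall_fin_two]
    simp [hε, pi_pos.le, mul_comm]
  have hm0 : Measurable (fun x : E => x 0) := by fun_prop
  have hm1 : Measurable (fun x : E => x 1) := by fun_prop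
  have hb : MeasurableSet (closedBall (0 : E) ε) := measurableSet_closedBall
  have m0 : MeasurableSet {x : E | x 0 < 0} := measurableSet_lt hm0 measurable_const
  have m0' : MeasurableSet {x : E | 0 < x 0} := measurableSet_lt measurable_const hm0
  have m1 : MeasurableSet {x : E | x 1 < 0} := measurableSet_lt hm1 measurable_const
  have m1' : MeasurableSet {x : E | 0 < x 1} := measurableSet_lt measurable_const hm1
  have hQ (p : E → Prop) : volume {x : E | x ∈ closedBall 0 ε ∧ p x} ≠ ⊤ :=
    measure_ne_top_of_subset (fun x hx => hx.1) measure_closedBall_lt_top.ne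
  have hm₂ : MeasurableSet {x : E | x ∈ closedBall 0 ε ∧ x 0 < 0 ∧ 0 < x 1} :=
    hb.inter (m0.inter m1')
  have hm₃ : MeasurableSet {x : E | x ∈ closedBall 0 ε ∧ 0 < x 0 ∧ x 1 < 0} :=
    hb.inter (m0'.inter m1)
  have hm₄ : MeasurableSet {x : E | x ∈ closedBall 0 ε ∧ 0 < x 0 ∧ 0 < x 1} :=
    hb.inter (m0'.inter m1')
  rw [← measureReal_union _ hm₂ (hQ _) (hQ _),
    ← measureReal_union _ hm₃ (measure_union_ne_top (hQ _) (hQ _)) (hQ _),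
    ← measureReal_union _ hm₄
      (measure_union_ne_top (measure_union_ne_top (hQ _) (hQ _)) (hQ _)) (hQ _), ← hD]
  · refine measureReal_mono ?_ measure_closedBall_lt_top.ne
    intro x hx
    simp only [mem_union, mem_ofPred_eq] at hx
    tauto
  all_goals
    rw [disjoint_left]
    simp only [mem_union, mem_ofPred_eq]
  · rintro x ((h | h) | h) h' <;> linarith [h.2.1, h.2.2, h'.2.1, h'.2.2]
  · rintro x (h | h) h' <;> linarith [h.2.1, h.2.2, h'.2.1, h'.2.2]
  · intro x h h'
    linarith [h.2.1, h.2.2, h'.2.1, h'.2.2]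

lemma sub_mem_closedBall_zero_iff {ε : ℝ} (hε : 0 ≤ ε) (x : E) (a b : ℝ) :
    x - !₂[a, b] ∈ closedBall 0 ε ↔ (x 0 - a) ^ 2 + (x 1 - b) ^ 2 ≤ ε ^ 2 := by
  rw [mem_closedBall_zero_iff, EuclideanSpace.norm_eq, Real.sqrt_le_left hε]
  simp [Fin.sum_univ_two]

/-- Nine sets covering the `ε`-neighbourhood of a Cantor dust: four quarter discs at the corners of
the unit square, and five rectangles that leave out a `2δ × δ` rectangle at the bottom. -/
def dustCover (ε δ : ℝ) : Fin 9 → Set E :=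
  ![{x | x - !₂[(0 : ℝ), 0] ∈ closedBall 0 ε ∧ (x - !₂[(0 : ℝ), 0]) 0 < 0 ∧ (x - !₂[(0 : ℝ), 0]) 1 < 0},
    {x | x - !₂[(0 : ℝ), 1] ∈ closedBall 0 ε ∧ (x - !₂[(0 : ℝ), 1]) 0 < 0 ∧ 0 < (x - !₂[(0 : ℝ), 1]) 1},
    {x | x - !₂[(1 : ℝ), 0] ∈ closedBall 0 ε ∧ 0 < (x - !₂[(1 : ℝ), 0]) 0 ∧ (x - !₂[(1 : ℝ), 0]) 1 < 0},
    {x | x - !₂[(1 : ℝ), 1] ∈ closedBall 0 ε ∧ 0 < (x - !₂[(1 : ℝ), 1]) 0 ∧ 0 < (x - !₂[(1 : ℝ), 1]) 1},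
    planeBox (-ε) (1 + ε) 0 1, planeBox 0 1 1 (1 + ε), planeBox 0 1 (-ε + δ) 0,
    planeBox 0 (1 / 2 - δ) (-ε) (-ε + δ), planeBox (1 / 2 + δ) 1 (-ε) (-ε + δ)]

lemma volume_dustCover_ne_top (ε δ : ℝ) (i : Fin 9) : volume (dustCover ε δ i) ≠ ⊤ := by
  have hK (v : E) (p : E → Prop) : volume {x : E | x - v ∈ closedBall 0 ε ∧ p x} ≠ ⊤ := by
    refine measure_ne_top_of_subset ?_
      (measure_closedBall_lt_top (x := v) (r := ε)).ne
    rintro x ⟨h, -⟩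
    rwa [mem_closedBall_zero_iff, ← dist_eq_norm] at h
  have hB (a b c d : ℝ) : volume (planeBox a b c d) ≠ ⊤ := by
    rw [volume_planeBox]; finiteness
  fin_cases i
  · exact hK _ _
  · exact hK _ _
  · exact hK _ _
  · exact hK _ _
  all_goals exact hB _ _ _ _

lemma sum_volume_dustCover_le {ε δ : ℝ} (hδ : 0 ≤ δ) (hδε : δ ≤ ε) (hδ2 : δ ≤ 1 / 2) :
    ∑ i, volume.real (dustCover ε δ i) ≤ 1 + 4 * ε + π * ε ^ 2 - 2 * δ ^ 2 := by
  have hε : 0 ≤ ε := hδ.trans hδε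
  have hK := volume_translated_quadrants_le hε !₂[(0 : ℝ), 0] !₂[(0 : ℝ), 1] !₂[(1 : ℝ), 0] !₂[(1 : ℝ), 1]
  have h₁ : volume.real (planeBox (-ε) (1 + ε) 0 1) = 1 + 2 * ε := by
    rw [volume_real_planeBox (by linarith) (by linarith)]; ring
  have h₂ : volume.real (planeBox 0 1 1 (1 + ε)) = ε := by
    rw [volume_real_planeBox (by linarith) (by linarith)]; ring
  have h₃ : volume.real (planeBox 0 1 (-ε + δ) 0) = ε - δ := by
    rw [volume_real_planeBox (by linarith) (by linarith)]; ring
  have h₄ : volume.real (planeBox 0 (1 / 2 - δ) (-ε) (-ε + δ)) = δ / 2 - δ ^ 2 := by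
    rw [volume_real_planeBox (by linarith) (by linarith)]; ring
  have h₅ : volume.real (planeBox (1 / 2 + δ) 1 (-ε) (-ε + δ)) = δ / 2 - δ ^ 2 := by
    rw [volume_real_planeBox (by linarith) (by linarith)]; ring
  have hsum (f : Fin 9 → ℝ) :
      ∑ i, f i = f 0 + f 1 + f 2 + f 3 + f 4 + f 5 + f 6 + f 7 + f 8 := by
    simp only [Fin.sum_univ_succ, Fin.sum_univ_zero]
    simp [Fin.succ]
    ring
  rw [hsum]
  change _ + volume.real (planeBox (-ε) (1 + ε) 0 1) + volume.real (planeBox 0 1 1 (1 + ε)) +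
    volume.real (planeBox 0 1 (-ε + δ) 0) +
    volume.real (planeBox 0 (1 / 2 - δ) (-ε) (-ε + δ)) +
    volume.real (planeBox (1 / 2 + δ) 1 (-ε) (-ε + δ)) ≤ _
  rw [h₁, h₂, h₃, h₄, h₅]
  refine (add_le_add_left (add_le_add_left (add_le_add_left (add_le_add_left
    (add_le_add_left hK _) _) _) _) _).trans (le_of_eq ?_)
  ring

lemma sub_sq_le_sub_sq {x a y : ℝ} (h : x ≤ a ∧ a ≤ y ∨ y ≤ a ∧ a ≤ x) :
    (x - a) ^ 2 ≤ (x - y) ^ 2 := by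
  rcases h with ⟨h, h'⟩ | ⟨h, h'⟩ <;> nlinarith

lemma mem_dustCover {ε δ q : ℝ} (hε : 0 < ε) (hq : 0 < q) (hε2 : ε ^ 2 = q ^ 2 / 2)
    (hδ : δ = q / 16) {x y : E} (hxy : (x 0 - y 0) ^ 2 + (x 1 - y 1) ^ 2 ≤ ε ^ 2)
    (h0 : y 0 ∈ Icc (0 : ℝ) 1) (h1 : y 1 ∈ Icc (0 : ℝ) 1)
    (hgap : y 0 ≤ (1 - q) / 2 ∨ 1 - (1 - q) / 2 ≤ y 0) : ∃ i, x ∈ dustCover ε δ i := by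
  have hx0 := abs_le.1 (abs_le_of_sq_le_sq
    (le_trans (le_add_of_nonneg_right (sq_nonneg _)) hxy) hε.le)
  have hx1 := abs_le.1 (abs_le_of_sq_le_sq
    (le_trans (le_add_of_nonneg_left (sq_nonneg _)) hxy) hε.le)
  obtain ⟨h0, h0'⟩ := h0
  obtain ⟨h1, h1'⟩ := h1
  have hK {a b : ℝ} (ha : x 0 ≤ a ∧ a ≤ y 0 ∨ y 0 ≤ a ∧ a ≤ x 0)
      (hb : x 1 ≤ b ∧ b ≤ y 1 ∨ y 1 ≤ b ∧ b ≤ x 1) : x - !₂[a, b] ∈ closedBall 0 ε := by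
    rw [sub_mem_closedBall_zero_iff hε.le]
    linarith [sub_sq_le_sub_sq ha, sub_sq_le_sub_sq hb]
  rcases lt_or_ge (x 1) 0 with c1 | c1
  · rcases lt_or_ge (x 0) 0 with c0 | c0
    · exact ⟨0, hK (.inl ⟨c0.le, h0⟩) (.inl ⟨c1.le, h1⟩), by simpa, by simpa⟩
    rcases lt_or_ge 1 (x 0) with c0' | c0'
    · exact ⟨2, hK (.inr ⟨h0', c0'.le⟩) (.inl ⟨c1.le, h1⟩), by simpa, by simpa⟩
    rcases le_or_gt (-ε + δ) (x 1) with c | c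
    · exact ⟨6, ⟨c0, c0'⟩, c, c1.le⟩
    rcases le_or_gt (x 0) (1 / 2 - δ) with d | d
    · exact ⟨7, ⟨c0, d⟩, by linarith, c.le⟩
    rcases le_or_gt (1 / 2 + δ) (x 0) with d' | d'
    · exact ⟨8, ⟨d', c0'⟩, by linarith, c.le⟩
    exfalso
    have hεq : ε < q := by nlinarith
    have hqε : q / 2 < ε := by nlinarith
    have e1 : (ε - δ) ^ 2 ≤ (x 1 - y 1) ^ 2 := by
      rw [← neg_sq (x 1 - y 1)]
      exact pow_le_pow_left₀ (by linarith) (by linarith) 2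
    have e0 : (q / 2 - δ) ^ 2 ≤ (x 0 - y 0) ^ 2 := by
      rcases hgap with h | h
      · exact pow_le_pow_left₀ (by linarith) (by linarith) 2
      · rw [← neg_sq (x 0 - y 0)]
        exact pow_le_pow_left₀ (by linarith) (by linarith) 2
    subst hδ
    have := mul_pos hq (sub_pos.2 hεq)
    nlinarith
  rcases lt_or_ge 1 (x 1) with c1' | c1'
  · rcases lt_or_ge (x 0) 0 with c0 | c0
    · exact ⟨1, hK (.inl ⟨c0.le, h0⟩) (.inr ⟨h1', c1'.le⟩), by simpa, by simpa⟩
    rcases lt_or_ge 1 (x 0) with c0' | c0'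
    · exact ⟨3, hK (.inr ⟨h0', c0'.le⟩) (.inr ⟨h1', c1'.le⟩), by simpa, by simpa⟩
    exact ⟨5, ⟨c0, c0'⟩, c1'.le, by linarith⟩
  · exact ⟨4, ⟨by linarith, by linarith⟩, c1, c1'⟩

lemma IsCantorDust.volume_cthickening_lt {r : ℝ} (hr : 2 < r) {C : Set E}
    (hC : IsCantorDust r C) {ε : ℝ} (hε : ε = √(1 / 2) * ((r - 2) / r)) :
    volume.real (cthickening ε C) < 1 + 4 * ε + π * ε ^ 2 := by
  have hr0 : 0 < r := by linarith
  set q := (r - 2) / r with hq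
  have hq0 : 0 < q := div_pos (by linarith) hr0
  have hq1 : q < 1 := by rw [hq, div_lt_one hr0]; linarith
  have hqr : 1 / r = (1 - q) / 2 := by rw [hq]; field_simp; ring
  have hε0 : 0 < ε := by rw [hε]; positivity
  have hε2 : ε ^ 2 = q ^ 2 / 2 := by
    rw [hε, mul_pow, Real.sq_sqrt (by norm_num)]; ring
  have hqε : q / 2 < ε := by nlinarith
  have hsub : cthickening ε C ⊆ ⋃ i, dustCover ε (q / 16) i := by
    intro x hx
    rw [hC.1.cthickening_eq_biUnion_closedBall hε0.le] at hx
    obtain ⟨y, hy, hxy⟩ := mem_iUnion₂.1 hx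
    rw [mem_closedBall, EuclideanSpace.dist_eq, Real.sqrt_le_left hε0.le, Fin.sum_univ_two,
      Real.dist_eq, Real.dist_eq, sq_abs, sq_abs] at hxy
    exact mem_iUnion.2 (mem_dustCover hε0 hq0 hε2 rfl hxy (hC.coord_mem_Icc hr 0 hy)
      (hC.coord_mem_Icc hr 1 hy) (hqr ▸ hC.coord_le_or_ge hr 0 hy))
  have hfin : volume (⋃ i, dustCover ε (q / 16) i) ≠ ⊤ := by
    refine ((measure_iUnion_le _).trans_lt ?_).ne
    rw [tsum_fintype]
    exact ENNReal.sum_lt_top.2 fun i _ => (volume_dustCover_ne_top _ _ i).lt_top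
  calc volume.real (cthickening ε C)
      ≤ volume.real (⋃ i, dustCover ε (q / 16) i) := measureReal_mono hsub hfin
    _ ≤ ∑ i, volume.real (dustCover ε (q / 16) i) := measureReal_iUnion_fintype_le _
    _ ≤ 1 + 4 * ε + π * ε ^ 2 - 2 * (q / 16) ^ 2 :=
        sum_volume_dustCover_le (by linarith) (by linarith) (by linarith)
    _ < 1 + 4 * ε + π * ε ^ 2 := by
        have : 0 < (q / 16) ^ 2 := by positivity
        linarith

/-- For `r > 2` and every `n ∈ ℕ`, with `ε = √(1/2)·((r-2)/r)·r^(-n)`, one has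
`λ²((C^r)_ε) / ε^(2 - D_r) < f₂(r)`, where `D_r = log 4 / log r`. -/
theorem stmt_10 (r : ℝ) (hr : 2 < r) (C : Set (EuclideanSpace ℝ (Fin 2)))
    (hC : IsCantorDust r C) (n : ℕ) :
    (volume (cthickening (Real.sqrt (1 / 2) * ((r - 2) / r) * r ^ (-(n : ℝ))) C)).toReal /
        (Real.sqrt (1 / 2) * ((r - 2) / r) * r ^ (-(n : ℝ))) ^ (2 - Real.log 4 / Real.log r) <
      f₂ r := by
  have hr0 : 0 < r := by linarith
  have hlog : 0 < Real.log r := Real.log_pos (by linarith)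
  set q := (r - 2) / r with hq
  have hq0 : 0 < q := div_pos (by linarith) hr0
  set D := Real.log 4 / Real.log r with hD
  set ε := √(1 / 2) * q with hε
  have hε0 : 0 < ε := by positivity
  have hrD : r ^ D = 4 := by
    rw [Real.rpow_def_of_pos hr0, hD, mul_div_cancel₀ _ hlog.ne', Real.exp_log (by norm_num)]
  have hrn : r ^ (-(n : ℝ)) = (r ^ n)⁻¹ := by
    rw [Real.rpow_neg hr0.le, Real.rpow_natCast]
  have hscale : (ε * r ^ (-(n : ℝ))) ^ (2 - D) = (4 / r ^ 2) ^ n * ε ^ (2 - D) := by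
    rw [Real.mul_rpow hε0.le (by positivity), ← Real.rpow_mul hr0.le, mul_comm]
    congr 1
    rw [show -(n : ℝ) * (2 - D) = (D - 2) * n by ring, Real.rpow_mul hr0.le, Real.rpow_natCast,
      Real.rpow_sub hr0, hrD, Real.rpow_two]
  have hden : 1 / 2 * q ^ 2 * √(1 / 2) ^ (-D) * q ^ (-D) = ε ^ (2 - D) := by
    rw [sub_eq_add_neg, Real.rpow_add hε0, Real.rpow_two, hε,
      Real.mul_rpow (by positivity) hq0.le, mul_pow, Real.sq_sqrt (by norm_num)]
    ring
  have hsqrt8 : √8 = 4 * √(1 / 2) := by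
    rw [show (8 : ℝ) = 4 ^ 2 * (1 / 2) by norm_num, Real.sqrt_mul (by positivity),
      Real.sqrt_sq (by norm_num)]
  have hnum : 1 + √8 * q + π / 2 * q ^ 2 = 1 + 4 * ε + π * ε ^ 2 := by
    rw [hsqrt8, hε, mul_pow, Real.sq_sqrt (by norm_num)]
    ring
  have hf : f₂ r = (1 + 4 * ε + π * ε ^ 2) / ε ^ (2 - D) := by
    rw [← hnum, ← hden]; rfl
  rw [hf, hscale, hrn, ← div_eq_mul_inv, ← measureReal_def, div_lt_div_iff₀ (by positivity)
    (by positivity)]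
  calc volume.real (cthickening (ε / r ^ n) C) * ε ^ (2 - D)
      ≤ (4 / r ^ 2) ^ n * volume.real (cthickening ε C) * ε ^ (2 - D) := by
        gcongr
        exact hC.volume_cthickening_mul_pow_le hr hε0.le n
    _ < (4 / r ^ 2) ^ n * (1 + 4 * ε + π * ε ^ 2) * ε ^ (2 - D) := by
        gcongr
        exact hC.volume_cthickening_lt hr hε
    _ = (1 + 4 * ε + π * ε ^ 2) * ((4 / r ^ 2) ^ n * ε ^ (2 - D)) := by ring
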